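/- For every real a > 0, ∫_ℝ φ(x)·( Φ(x/a) )² dx = 1 − 2·∫_ℝ φ(x)·Φ(x)·Φ(a·x) dx. -/

import Mathlib

open MeasureTheory Real

/-- The standard normal density. -/
noncomputable def stdNormalPDF (x : ℝ) : ℝ :=
  (1 / Real.sqrt (2 * Real.pi)) * Real.exp (-x^2 / 2)

/-- The standard normal cumulative distribution function. -/
noncomputable def stdNormalCDF (x : ℝ) : ℝ :=
  ∫ t in Set.Iic x, stdNormalPDF t

open ProbabilityTheory Filter Topology

theorem stdNormalPDF_eq_gaussianPDFReal : stdNormalPDF = gaussianPDFReal 0 1 := by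
  ext x
  simp [stdNormalPDF, gaussianPDFReal]

theorem continuous_stdNormalPDF : Continuous stdNormalPDF := by
  unfold stdNormalPDF
  fun_prop

theorem integrable_stdNormalPDF : Integrable stdNormalPDF :=
  stdNormalPDF_eq_gaussianPDFReal ▸ integrable_gaussianPDFReal 0 1

theorem stdNormalCDF_eq_cdf : stdNormalCDF = cdf (gaussianReal 0 1) := by
  ext x
  rw [cdf_eq_real, measureReal_def, gaussianReal_apply_eq_integral 0 one_ne_zero,
    ENNReal.toReal_ofReal (integral_nonneg fun y => gaussianPDFReal_nonneg 0 1 y),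
    stdNormalCDF, stdNormalPDF_eq_gaussianPDFReal]

theorem hasDerivAt_stdNormalCDF (x : ℝ) : HasDerivAt stdNormalCDF (stdNormalPDF x) x := by
  have h : stdNormalCDF = fun y => stdNormalCDF 0 + ∫ t in (0 : ℝ)..y, stdNormalPDF t := by
    ext y
    rw [← intervalIntegral.integral_Iic_sub_Iic integrable_stdNormalPDF.integrableOn
      integrable_stdNormalPDF.integrableOn]
    simp [stdNormalCDF]
  rw [h]
  exact (intervalIntegral.integral_hasDerivAt_right
    (continuous_stdNormalPDF.intervalIntegrable _ _)
    (continuous_stdNormalPDF.stronglyMeasurableAtFilter _ _)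
    continuous_stdNormalPDF.continuousAt).const_add _

theorem continuous_stdNormalCDF : Continuous stdNormalCDF :=
  continuous_iff_continuousAt.2 fun x => (hasDerivAt_stdNormalCDF x).continuousAt

theorem norm_stdNormalCDF_le_one (x : ℝ) : ‖stdNormalCDF x‖ ≤ 1 := by
  rw [stdNormalCDF_eq_cdf, Real.norm_of_nonneg (cdf_nonneg _ x)]
  exact cdf_le_one _ x

theorem tendsto_stdNormalCDF_atBot : Tendsto stdNormalCDF atBot (𝓝 0) :=
  stdNormalCDF_eq_cdf ▸ tendsto_cdf_atBot _

theorem tendsto_stdNormalCDF_atTop : Tendsto stdNormalCDF atTop (𝓝 1) :=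
  stdNormalCDF_eq_cdf ▸ tendsto_cdf_atTop _

theorem MeasureTheory.Integrable.mul_stdNormalCDF_comp {f g : ℝ → ℝ} (hf : Integrable f)
    (hg : Continuous g) : Integrable fun x => f x * stdNormalCDF (g x) :=
  hf.mul_bdd (c := 1) (continuous_stdNormalCDF.comp hg).aestronglyMeasurable
    (ae_of_all _ fun x => norm_stdNormalCDF_le_one (g x))

/-- For every `a > 0`, `∫ φ(x) (Φ(x/a))² dx = 1 − 2 ∫ φ(x) Φ(x) Φ(ax) dx`. -/
theorem integral_cdf_sq_eq (a : ℝ) (ha : 0 < a) :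
    (∫ x : ℝ, stdNormalPDF x * (stdNormalCDF (x / a))^2)
      = 1 - 2 * ∫ x : ℝ, stdNormalPDF x * stdNormalCDF x * stdNormalCDF (a * x) := by
  have hderiv (x : ℝ) : HasDerivAt (fun x => stdNormalCDF x ^ 2 * stdNormalCDF (a * x))
      (2 * (stdNormalPDF x * stdNormalCDF x * stdNormalCDF (a * x)) +
        a * (stdNormalPDF (a * x) * stdNormalCDF x * stdNormalCDF x)) x := by
    have h₁ := (hasDerivAt_stdNormalCDF x).pow 2
    have h₂ := (hasDerivAt_stdNormalCDF (a * x)).comp x ((hasDerivAt_id x).const_mul a)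
    refine (h₁.mul h₂).congr_deriv ?_
    simp
    ring
  have hint₁ : Integrable fun x => stdNormalPDF x * stdNormalCDF x * stdNormalCDF (a * x) :=
    (integrable_stdNormalPDF.mul_stdNormalCDF_comp continuous_id).mul_stdNormalCDF_comp
      (continuous_const_mul a)
  have hint₂ : Integrable fun x => stdNormalPDF (a * x) * stdNormalCDF x * stdNormalCDF x :=
    ((integrable_stdNormalPDF.comp_mul_left' ha.ne').mul_stdNormalCDF_comp
      continuous_id).mul_stdNormalCDF_comp continuous_id
  have hbot : Tendsto (fun x => stdNormalCDF x ^ 2 * stdNormalCDF (a * x)) atBot (𝓝 0) := by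
    simpa using (tendsto_stdNormalCDF_atBot.pow 2).mul
      (tendsto_stdNormalCDF_atBot.comp (tendsto_id.const_mul_atBot ha))
  have htop : Tendsto (fun x => stdNormalCDF x ^ 2 * stdNormalCDF (a * x)) atTop (𝓝 1) := by
    simpa using (tendsto_stdNormalCDF_atTop.pow 2).mul
      (tendsto_stdNormalCDF_atTop.comp (tendsto_id.const_mul_atTop ha))
  have hparts := integral_of_hasDerivAt_of_tendsto hderiv
    ((hint₁.const_mul 2).add (hint₂.const_mul a)) hbot htop
  rw [integral_add (hint₁.const_mul 2) (hint₂.const_mul a), integral_const_mul,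
    integral_const_mul] at hparts
  have hscale : a * ∫ x, stdNormalPDF (a * x) * stdNormalCDF x * stdNormalCDF x =
      ∫ x, stdNormalPDF x * stdNormalCDF (x / a) ^ 2 := by
    have h := Measure.integral_comp_mul_left
      (fun x => stdNormalPDF x * stdNormalCDF (x / a) ^ 2) a
    simp only [mul_div_cancel_left₀ _ ha.ne', abs_of_pos (inv_pos.2 ha), smul_eq_mul] at h
    simp only [mul_assoc, ← pow_two, h]
    rw [mul_inv_cancel_left₀ ha.ne']
  linarith
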